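/- Let l > 3 be a prime and k an algebraic extension of F_l. Let k' be a finite subfield of k of cardinality greater than 5, and suppose H is a finite subgroup of GL_2(k) with SL_2(k') ⊆ H. Then H is 2-big. -/

import Mathlib

open Matrix Polynomial

/-- The `h`-equivariant projection from `k²` onto the `α`-eigenspace of a `2 × 2` matrix `A`
for which `α` is a simple root of the characteristic polynomial (the other root then being
`trace A - α`): it is the polynomial `(A - β • 1) / (α - β)` in `A`, where `β = trace A - α`. -/
noncomputable def eigProj {k : Type*} [Field k] (A : Matrix (Fin 2) (Fin 2) k) (α : k) :
    Matrix (Fin 2) (Fin 2) k :=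
  (α - (A.trace - α))⁻¹ • (A - (A.trace - α) • (1 : Matrix (Fin 2) (Fin 2) k))

/-- A subgroup `H` of `GL 2 k` is `m`-big: (i) `H` has no quotient of `l`-power order;
(ii) `H⁰(H, 𝔰𝔩₂(k)) = 0`; (iii) `H¹(H, 𝔰𝔩₂(k)) = 0` (every conjugation 1-cocycle valued in
trace-zero matrices is a coboundary); (iv) for every irreducible `k[H]`-submodule `W` of
`𝔤𝔩₂(k)` there are `h ∈ H` and `α ∈ k` with `α` a simple root of the characteristic
polynomial of `h`, `α^m ≠ β^m` for every other root `β`, and `π_{h,α} ∘ w ∘ i_{h,α} ≠ 0`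
for some `w ∈ W`. -/
def IsMBig (l m : ℕ) {k : Type*} [Field k] (H : Subgroup (GL (Fin 2) k)) : Prop :=
  (∀ N : Subgroup H, N.Normal → ∀ j : ℕ, Nat.card (H ⧸ N) ≠ l ^ (j + 1)) ∧
  (∀ X : Matrix (Fin 2) (Fin 2) k, X.trace = 0 →
    (∀ h : H, (h : GL (Fin 2) k).val * X = X * (h : GL (Fin 2) k).val) → X = 0) ∧
  (∀ c : H → Matrix (Fin 2) (Fin 2) k,
    (∀ g : H, (c g).trace = 0) →
    (∀ g h : H, c (g * h) =
      c g + (g : GL (Fin 2) k).val * c h * ((g : GL (Fin 2) k)⁻¹).val) →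
    ∃ X : Matrix (Fin 2) (Fin 2) k, X.trace = 0 ∧
      ∀ g : H, c g = (g : GL (Fin 2) k).val * X * ((g : GL (Fin 2) k)⁻¹).val - X) ∧
  (∀ W : Submodule k (Matrix (Fin 2) (Fin 2) k),
    (∀ w ∈ W, ∀ h : H, (h : GL (Fin 2) k).val * w * ((h : GL (Fin 2) k)⁻¹).val ∈ W) →
    W ≠ ⊥ →
    (∀ W' : Submodule k (Matrix (Fin 2) (Fin 2) k), W' ≤ W →
      (∀ w ∈ W', ∀ h : H, (h : GL (Fin 2) k).val * w * ((h : GL (Fin 2) k)⁻¹).val ∈ W') →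
      W' = ⊥ ∨ W' = W) →
    ∃ h : H, ∃ α : k,
      (h : GL (Fin 2) k).val.charpoly.rootMultiplicity α = 1 ∧
      (∀ β : k, (h : GL (Fin 2) k).val.charpoly.IsRoot β → β ≠ α → α ^ m ≠ β ^ m) ∧
      ∃ w ∈ W, eigProj (h : GL (Fin 2) k).val α * w * eigProj (h : GL (Fin 2) k).val α ≠ 0)


section helpers

variable {k : Type*} [Field k]

private lemma tr_det_of_nilp {N : Matrix (Fin 2) (Fin 2) k} (h : IsNilpotent N) :
    N.trace = 0 ∧ N.det = 0 := by
  refine ⟨(Matrix.isNilpotent_trace_of_isNilpotent h).eq_zero, ?_⟩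
  obtain ⟨n, hn⟩ := h
  have : N.det ^ n = 0 := by rw [← Matrix.det_pow, hn]; simp
  rcases Nat.eq_zero_or_pos n with h0 | h0
  · subst h0; simp at this
  · exact pow_eq_zero_iff (by omega) |>.1 this

private lemma nilp_sub_one (l : ℕ) [Fact l.Prime] [CharP k l] (A : Matrix (Fin 2) (Fin 2) k)
    (n : ℕ) (h : A ^ (l ^ n) = 1) : IsNilpotent (A - 1) := by
  refine ⟨l ^ n, ?_⟩
  rw [sub_pow_char_pow_of_commute l n (Commute.one_right A), h]
  simp

private lemma pow_lin (A : Matrix (Fin 2) (Fin 2) k) (n : ℕ) :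
    ∃ x y : k, A ^ n = x • A + y • (1 : Matrix (Fin 2) (Fin 2) k) := by
  induction n with
  | zero => exact ⟨0, 1, by simp⟩
  | succ n ih =>
    obtain ⟨x, y, h⟩ := ih
    refine ⟨x * A.trace + y, - x * A.det, ?_⟩
    rw [pow_succ, h]
    ext i j
    fin_cases i <;> fin_cases j <;>
      simp [Matrix.mul_apply, Fin.sum_univ_two, Matrix.trace_fin_two, Matrix.det_fin_two] <;> ring

private lemma not_dvd_order (l : ℕ) [Fact l.Prime] [CharP k l] (h2 : (2 : k) ≠ 0)
    (g : GL (Fin 2) k) (h0 : orderOf g ≠ 0)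
    (hd : g.val.trace ^ 2 ≠ 4 * g.val.det) : ¬ l ∣ orderOf g := by
  rintro ⟨n, hn⟩
  have hl := (Fact.out : l.Prime).two_le
  obtain ⟨x, y, hxy⟩ := pow_lin g.val n
  have h1 : (g.val ^ n) ^ (l ^ 1) = 1 := by
    rw [← pow_mul, pow_one, mul_comm, ← hn, ← Units.val_pow_eq_pow_val, pow_orderOf_eq_one]; rfl
  obtain ⟨ht, hdd⟩ := tr_det_of_nilp (nilp_sub_one l _ _ h1)
  rw [hxy] at ht hdd
  simp [Matrix.trace_fin_two, Matrix.det_fin_two] at ht hdd hd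
  have hx : x = 0 := by
    by_contra hx
    apply hd
    have : x ^ 2 * ((g.val 0 0 + g.val 1 1) ^ 2 -
      4 * (g.val 0 0 * g.val 1 1 - g.val 0 1 * g.val 1 0)) = 0 := by
      linear_combination (x * g.val 0 0 + y - 1 + (x * g.val 1 1 + y - 1)) * ht - 4 * hdd
    rcases mul_eq_zero.1 this with h | h
    · exact absurd h (pow_ne_zero 2 hx)
    · linear_combination h
  subst hx
  have hy : y = 1 := by
    have : 2 * (y - 1) = 0 := by linear_combination ht
    rcases mul_eq_zero.1 this with h | h
    · exact absurd h h2
    · linear_combination h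
  subst hy
  have hgn : g ^ n = 1 := by
    apply Units.ext
    rw [Units.val_pow_eq_pow_val, hxy]; simp
  have hn0 : 0 < n := by
    rcases Nat.eq_zero_or_pos n with h | h
    · subst h; exact absurd (by simpa using hn) h0
    · exact h
  have := Nat.le_of_dvd hn0 (orderOf_dvd_of_pow_eq_one hgn)
  nlinarith

private lemma coc_tr (H : Subgroup (GL (Fin 2) k)) (c : H → Matrix (Fin 2) (Fin 2) k)
    (hc : ∀ g h : H, c (g * h) =
      c g + (g : GL (Fin 2) k).val * c h * ((g : GL (Fin 2) k)⁻¹).val)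
    (g : H) (n : ℕ) (hg : g ^ n = 1) (hn : (n : k) ≠ 0) :
    (c g * (g : GL (Fin 2) k).val).trace = 0 := by
  have h1 : c 1 = 0 := by have := hc 1 1; simpa using this
  have key : ∀ m : ℕ, (c (g ^ m) * (g : GL (Fin 2) k).val).trace =
      m * (c g * (g : GL (Fin 2) k).val).trace := by
    intro m
    induction m with
    | zero => simp [h1]
    | succ m ih =>
      have e : (((g ^ m : H) : GL (Fin 2) k)⁻¹).val * (g : GL (Fin 2) k).val *
          ((g ^ m : H) : GL (Fin 2) k).val = (g : GL (Fin 2) k).val := by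
        rw [← Units.val_mul, ← Units.val_mul]
        congr 1
        push_cast
        group
      rw [pow_succ, hc, add_mul, Matrix.trace_add, ih, mul_assoc, mul_assoc,
        Matrix.trace_mul_comm (((g ^ m : H) : GL (Fin 2) k).val), mul_assoc, e]
      push_cast; ring
  have := key n
  rw [hg, h1] at this
  simp at this
  tauto

private def uu (b : k) : GL (Fin 2) k :=
  ⟨!![1, b; 0, 1], !![1, -b; 0, 1],
    by ext i j; fin_cases i <;> fin_cases j <;> simp,
    by ext i j; fin_cases i <;> fin_cases j <;> simp⟩

private def ww : GL (Fin 2) k :=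
  ⟨!![0, 1; -1, 0], !![0, -1; 1, 0],
    by ext i j; fin_cases i <;> fin_cases j <;> simp,
    by ext i j; fin_cases i <;> fin_cases j <;> simp⟩

private def tt (a : k) (ha : a ≠ 0) : GL (Fin 2) k :=
  ⟨!![a, 0; 0, a⁻¹], !![a⁻¹, 0; 0, a],
    by ext i j; fin_cases i <;> fin_cases j <;> simp [ha],
    by ext i j; fin_cases i <;> fin_cases j <;> simp [ha]⟩

private lemma uu_val (b : k) : (uu b).val = !![1, b; 0, 1] := rfl
private lemma uu_inv (b : k) : ((uu b)⁻¹).val = !![1, -b; 0, 1] := rfl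
private lemma ww_val : (ww (k := k)).val = !![0, 1; -1, 0] := rfl
private lemma ww_inv : ((ww (k := k))⁻¹).val = !![0, -1; 1, 0] := rfl
private lemma tt_val (a : k) (ha : a ≠ 0) : (tt a ha).val = !![a, 0; 0, a⁻¹] := rfl
private lemma tt_inv (a : k) (ha : a ≠ 0) : ((tt a ha)⁻¹).val = !![a⁻¹, 0; 0, a] := rfl

/-- There is a Sylow subgroup consisting of upper unipotents. -/
private lemma exists_sylow (l : ℕ) [Fact l.Prime] [CharP k l] (H : Subgroup (GL (Fin 2) k))
    [Finite H] (hu : uu (1 : k) ∈ H) :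
    ∃ P : Sylow l H, ∀ g ∈ P, ∃ b : k, (g : GL (Fin 2) k) = uu b := by
  have hp : IsPGroup l (Subgroup.zpowers (⟨uu 1, hu⟩ : H)) := by
    have hpow : ∀ n : ℕ, (uu (1 : k)) ^ n = uu (n : k) := by
      intro n
      induction n with
      | zero => apply Units.ext; ext i j; fin_cases i <;> fin_cases j <;> simp [uu_val]
      | succ n ih =>
        rw [pow_succ, ih]
        apply Units.ext; rw [Units.val_mul, uu_val, uu_val, uu_val]
        ext i j; fin_cases i <;> fin_cases j <;> simp [add_comm]
    have : (⟨uu 1, hu⟩ : H) ^ l = 1 := by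
      apply Subtype.ext
      push_cast
      rw [hpow]
      apply Units.ext; ext i j; fin_cases i <;> fin_cases j <;> simp [uu_val]
    rw [IsPGroup.iff_card]
    obtain ⟨m, -, hm⟩ := (Nat.dvd_prime_pow (Fact.out : l.Prime)).1
      (show orderOf (⟨uu 1, hu⟩ : H) ∣ l ^ 1 by
        rw [pow_one]; exact orderOf_dvd_of_pow_eq_one this)
    exact ⟨m, by rw [Nat.card_zpowers, hm]⟩
  obtain ⟨P, hP⟩ := hp.exists_le_sylow
  have hu1 : (⟨uu 1, hu⟩ : H) ∈ P := hP (Subgroup.mem_zpowers _)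
  have nil : ∀ g ∈ P, IsNilpotent ((g : GL (Fin 2) k).val - 1) := by
    intro g hg
    obtain ⟨n, hn⟩ := P.isPGroup' ⟨g, hg⟩
    apply nilp_sub_one l _ n
    have : g ^ (l ^ n) = 1 := congrArg Subtype.val hn
    have : (g : GL (Fin 2) k) ^ (l ^ n) = 1 := congrArg Subtype.val this
    rw [← Units.val_pow_eq_pow_val, this]; rfl
  refine ⟨P, fun g hg => ⟨(g : GL (Fin 2) k).val 0 1, ?_⟩⟩
  obtain ⟨t1, d1⟩ := tr_det_of_nilp (nil g hg)
  obtain ⟨t2, -⟩ := tr_det_of_nilp (nil _ (mul_mem hu1 hg))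
  simp [Matrix.trace_fin_two, Matrix.det_fin_two, uu_val, Matrix.mul_apply,
    Fin.sum_univ_two, Matrix.vecMul, dotProduct] at t1 d1 t2
  have h10 : (g : GL (Fin 2) k).val 1 0 = 0 := by linear_combination t2 - t1
  rw [h10] at d1
  have h00 : (g : GL (Fin 2) k).val 0 0 = 1 := by
    have : ((g : GL (Fin 2) k).val 0 0 - 1) ^ 2 = 0 := by
      linear_combination ((g : GL (Fin 2) k).val 0 0 - 1) * t1 - d1
    have := pow_eq_zero_iff (two_ne_zero) |>.1 this
    linear_combination this
  have h11 : (g : GL (Fin 2) k).val 1 1 = 1 := by linear_combination t1 - h00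
  apply Units.ext
  ext i j
  fin_cases i <;> fin_cases j <;> simp [uu_val, h10, h00, h11]

private lemma part_i (l : ℕ) [Fact l.Prime] [CharP k l] (H : Subgroup (GL (Fin 2) k))
    [Finite H] (hu : uu (1 : k) ∈ H) (h2 : (2 : k) ≠ 0) (a : k) (ha : a ≠ 0)
    (ha2 : a ^ 2 ≠ 1) (ht : tt a ha ∈ H)
    (N : Subgroup H) (hN : N.Normal) (j : ℕ) : Nat.card (H ⧸ N) ≠ l ^ (j + 1) := by
  intro hcard
  obtain ⟨P, hP⟩ := exists_sylow l H hu
  have hl := (Fact.out : l.Prime)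
  set t : H := ⟨tt a ha, ht⟩ with htd
  have htord : ¬ l ∣ orderOf t := by
    rw [← Subgroup.orderOf_coe]
    apply not_dvd_order l h2
    · rw [Subgroup.orderOf_coe]; exact (orderOf_pos t).ne'
    · simp only [htd, tt_val]
      simp [Matrix.trace_fin_two, Matrix.det_fin_two, ha]
      intro h
      apply ha2
      field_simp at h
      have : (a ^ 2 - 1) ^ 2 = 0 := by linear_combination h
      have := pow_eq_zero_iff (two_ne_zero) |>.1 this
      linear_combination this
  have htN : t ∈ N := by
    rw [← QuotientGroup.eq_one_iff, ← orderOf_eq_one_iff]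
    have h1 : orderOf (t : H ⧸ N) ∣ l ^ (j + 1) := hcard ▸ orderOf_dvd_natCard _
    have h2 : orderOf (t : H ⧸ N) ∣ orderOf t := orderOf_map_dvd (QuotientGroup.mk' N) t
    exact Nat.eq_one_of_dvd_coprimes ((Nat.Coprime.pow_left _ (hl.coprime_iff_not_dvd.2 htord))) h1 h2
  -- the subgroup of all upper unipotents of H is inside N
  let B : Set k := {b | uu b ∈ H}
  have hBinj : Function.Injective (fun b : B => (⟨uu b.1, b.2⟩ : H)) := by
    intro b b' h
    have h1 : uu b.1 = uu b'.1 := congrArg Subtype.val h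
    have h2 : (uu b.1).val 0 1 = (uu b'.1).val 0 1 := by rw [h1]
    simp [uu_val] at h2
    exact Subtype.ext h2
  have : Finite B := Finite.of_injective _ hBinj
  have hcomm : ∀ b : k, tt a ha * uu b * (tt a ha)⁻¹ * (uu b)⁻¹ = uu ((a ^ 2 - 1) * b) := by
    intro b
    apply Units.ext
    simp only [Units.val_mul, tt_val, tt_inv, uu_val, uu_inv]
    ext i j; fin_cases i <;> fin_cases j <;> simp [ha]
    ring
  let φ : B → B := fun b => ⟨(a ^ 2 - 1) * b.1, by
    change uu _ ∈ H
    rw [← hcomm]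
    exact H.mul_mem (H.mul_mem (H.mul_mem ht b.2) (H.inv_mem ht)) (H.inv_mem b.2)⟩
  have hφ : Function.Injective φ := by
    intro b b' h
    have := congrArg Subtype.val h
    exact Subtype.ext (mul_left_cancel₀ (sub_ne_zero.2 ha2) this)
  have hφs : Function.Surjective φ := Finite.surjective_of_injective hφ
  have hPN : (P : Subgroup H) ≤ N := by
    intro g hg
    obtain ⟨b, hb⟩ := hP g hg
    obtain ⟨b', hb'⟩ := hφs ⟨b, by change uu b ∈ H; rw [← hb]; exact g.2⟩
    have e : (a ^ 2 - 1) * b'.1 = b := congrArg Subtype.val hb'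
    have hg' : g = t * ((⟨uu b'.1, b'.2⟩ : H) * t⁻¹ * (⟨uu b'.1, b'.2⟩ : H)⁻¹) := by
      apply Subtype.ext
      rw [hb, ← e, ← hcomm]
      push_cast
      simp only [htd, mul_assoc]
    rw [hg']
    exact N.mul_mem htN (hN.conj_mem _ (N.inv_mem htN) _)
  have h1 : N.index ∣ (P : Subgroup H).index := Subgroup.index_dvd_of_le hPN
  have h3 : ¬ l ∣ (P : Subgroup H).index := P.not_dvd_index
  apply h3
  refine dvd_trans ?_ h1
  rw [Subgroup.index, hcard]
  exact dvd_pow_self _ (by omega)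

private lemma part_iii (l : ℕ) [Fact l.Prime] [CharP k l] (H : Subgroup (GL (Fin 2) k))
    [Finite H] (hu : uu (1 : k) ∈ H) (hw : ww (k := k) ∈ H)
    (h2 : (2 : k) ≠ 0) (h3 : (3 : k) ≠ 0) (a : k) (ha : a ≠ 0)
    (ha4 : a ^ 4 ≠ 1) (ht : tt a ha ∈ H)
    (c : H → Matrix (Fin 2) (Fin 2) k)
    (htr : ∀ g : H, (c g).trace = 0)
    (hc : ∀ g h : H, c (g * h) =
      c g + (g : GL (Fin 2) k).val * c h * ((g : GL (Fin 2) k)⁻¹).val) :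
    ∃ X : Matrix (Fin 2) (Fin 2) k, X.trace = 0 ∧
      ∀ g : H, c g = (g : GL (Fin 2) k).val * X * ((g : GL (Fin 2) k)⁻¹).val - X := by
  have hl := (Fact.out : l.Prime)
  have ha2 : a ^ 2 - 1 ≠ 0 := fun h => ha4 (by linear_combination (a ^ 2 + 1) * h)
  have ha2' : a ^ 2 + 1 ≠ 0 := fun h => ha4 (by linear_combination (a ^ 2 - 1) * h)
  -- coboundary shift
  have shift : ∀ (c : H → Matrix (Fin 2) (Fin 2) k) (X : Matrix (Fin 2) (Fin 2) k),
      X.trace = 0 → (∀ g : H, (c g).trace = 0) →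
      (∀ g h : H, c (g * h) =
        c g + (g : GL (Fin 2) k).val * c h * ((g : GL (Fin 2) k)⁻¹).val) →
      (∀ g : H, (c g - ((g : GL (Fin 2) k).val * X * ((g : GL (Fin 2) k)⁻¹).val - X)).trace = 0) ∧
      (∀ g h : H, c (g * h) - (((g * h : H) : GL (Fin 2) k).val * X *
          (((g * h : H) : GL (Fin 2) k)⁻¹).val - X) =
        (c g - ((g : GL (Fin 2) k).val * X * ((g : GL (Fin 2) k)⁻¹).val - X)) +
        (g : GL (Fin 2) k).val *
          (c h - ((h : GL (Fin 2) k).val * X * ((h : GL (Fin 2) k)⁻¹).val - X)) *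
          ((g : GL (Fin 2) k)⁻¹).val) := by
    intro c X hX htr hc
    constructor
    · intro g
      rw [Matrix.trace_sub, Matrix.trace_sub, htr, hX, Matrix.trace_mul_comm, ← mul_assoc,
        ← Units.val_mul, inv_mul_cancel]
      simp [hX]
    · intro g h
      rw [hc, Subgroup.coe_mul, _root_.mul_inv_rev, Units.val_mul, Units.val_mul]
      noncomm_ring
  -- traces vanish on regular semisimple elements
  have tr0 : ∀ (c : H → Matrix (Fin 2) (Fin 2) k),
      (∀ g h : H, c (g * h) =
        c g + (g : GL (Fin 2) k).val * c h * ((g : GL (Fin 2) k)⁻¹).val) →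
      ∀ g : H, (g : GL (Fin 2) k).val.trace ^ 2 ≠ 4 * (g : GL (Fin 2) k).val.det →
      (c g * (g : GL (Fin 2) k).val).trace = 0 := by
    intro c hc g hg
    apply coc_tr H c hc g (orderOf g) (pow_orderOf_eq_one g)
    intro h
    rw [CharP.cast_eq_zero_iff k l, ← Subgroup.orderOf_coe] at h
    refine not_dvd_order l h2 _ ?_ hg h
    rw [Subgroup.orderOf_coe]; exact (orderOf_pos g).ne'
  set t : H := ⟨tt a ha, ht⟩ with htd
  set w : H := ⟨ww, hw⟩ with hwd
  have tv : (t : GL (Fin 2) k).val = !![a, 0; 0, a⁻¹] := rfl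
  have ti : ((t : GL (Fin 2) k)⁻¹).val = !![a⁻¹, 0; 0, a] := rfl
  have wv : (w : GL (Fin 2) k).val = !![0, 1; -1, 0] := rfl
  have wi : ((w : GL (Fin 2) k)⁻¹).val = !![0, -1; 1, 0] := rfl
  have hdisc : (a + a⁻¹) ^ 2 ≠ 4 := by
    intro h
    apply ha2
    field_simp at h
    have : (a ^ 2 - 1) ^ 2 = 0 := by linear_combination h
    exact pow_eq_zero_iff (two_ne_zero) |>.1 this
  -- main reduction: enough when c t = 0
  suffices main : ∀ c : H → Matrix (Fin 2) (Fin 2) k, (∀ g : H, (c g).trace = 0) →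
      (∀ g h : H, c (g * h) =
        c g + (g : GL (Fin 2) k).val * c h * ((g : GL (Fin 2) k)⁻¹).val) → c t = 0 → c w = 0 →
      ∃ X : Matrix (Fin 2) (Fin 2) k, X.trace = 0 ∧
      ∀ g : H, c g = (g : GL (Fin 2) k).val * X * ((g : GL (Fin 2) k)⁻¹).val - X by
    have step : ∀ c : H → Matrix (Fin 2) (Fin 2) k, ∀ Y : Matrix (Fin 2) (Fin 2) k,
        Y.trace = 0 → (∃ X : Matrix (Fin 2) (Fin 2) k, X.trace = 0 ∧
        ∀ g : H, c g - ((g : GL (Fin 2) k).val * Y * ((g : GL (Fin 2) k)⁻¹).val - Y) =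
          (g : GL (Fin 2) k).val * X * ((g : GL (Fin 2) k)⁻¹).val - X) →
        ∃ X : Matrix (Fin 2) (Fin 2) k, X.trace = 0 ∧
        ∀ g : H, c g = (g : GL (Fin 2) k).val * X * ((g : GL (Fin 2) k)⁻¹).val - X := by
      rintro c Y hY ⟨X, hX, h⟩
      refine ⟨X + Y, by rw [Matrix.trace_add, hX, hY, add_zero], fun g => ?_⟩
      rw [mul_add, add_mul, eq_add_of_sub_eq (h g)]
      abel
    -- main2 : with c t = 0
    have main2 : ∀ c : H → Matrix (Fin 2) (Fin 2) k, (∀ g : H, (c g).trace = 0) →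
      (∀ g h : H, c (g * h) =
        c g + (g : GL (Fin 2) k).val * c h * ((g : GL (Fin 2) k)⁻¹).val) → c t = 0 →
      ∃ X : Matrix (Fin 2) (Fin 2) k, X.trace = 0 ∧
      ∀ g : H, c g = (g : GL (Fin 2) k).val * X * ((g : GL (Fin 2) k)⁻¹).val - X := by
      intro c htr hc hct
      have hrel : t * (w * t) = w := by
        apply Subtype.ext
        apply Units.ext
        push_cast
        rw [tv, wv]
        ext i j; fin_cases i <;> fin_cases j <;> simp [ha]
      have e := hc t (w * t)
      rw [hrel, hc w t, hct] at e
      have e01 := congrFun (congrFun e 0) 1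
      have e10 := congrFun (congrFun e 1) 0
      rw [tv, ti] at e01 e10
      have hq : c w 0 1 = 0 := by
        simp [Matrix.mul_apply, Fin.sum_univ_two, Matrix.vecMul, dotProduct] at e01
        have : (a ^ 2 - 1) * c w 0 1 = 0 := by linear_combination -e01
        exact (mul_eq_zero.1 this).resolve_left ha2
      have hr : c w 1 0 = 0 := by
        simp [Matrix.mul_apply, Fin.sum_univ_two, Matrix.vecMul, dotProduct] at e10
        field_simp at e10
        have : (a ^ 2 - 1) * c w 1 0 = 0 := by linear_combination e10
        exact (mul_eq_zero.1 this).resolve_left ha2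
      have hp := htr w
      rw [Matrix.trace_fin_two] at hp
      set Y : Matrix (Fin 2) (Fin 2) k := !![-(c w 0 0) / 2, 0; 0, (c w 0 0) / 2] with hYd
      have hY : Y.trace = 0 := by simp [hYd, Matrix.trace_fin_two]; ring
      apply step c Y hY
      obtain ⟨h1, h2'⟩ := shift c Y hY htr hc
      refine main (fun g => c g - ((g : GL (Fin 2) k).val * Y * ((g : GL (Fin 2) k)⁻¹).val - Y))
        h1 h2' ?_ ?_
      · simp only [hct, tv, ti, hYd]
        ext i j; fin_cases i <;> fin_cases j <;> simp
        · field_simp; ring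
        · field_simp; ring
      · simp only [wv, wi]
        ext i j; fin_cases i <;> fin_cases j <;> simp [hYd, hq, hr]
        · field_simp; ring
        · field_simp; linear_combination 2 * hp
    -- general
    have e1 := tr0 c hc t (by
      rw [tv]; simpa [Matrix.trace_fin_two, Matrix.det_fin_two, ha] using hdisc)
    have e2 := htr t
    rw [tv] at e1
    simp [Matrix.trace_fin_two, Matrix.mul_apply, Fin.sum_univ_two, Matrix.vecMul, dotProduct] at e1 e2
    have hp : c t 0 0 = 0 := by
      field_simp at e1
      have : (a ^ 2 - 1) * c t 0 0 = 0 := by linear_combination e1 - e2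
      exact (mul_eq_zero.1 this).resolve_left ha2
    have hs : c t 1 1 = 0 := by linear_combination e2 - hp
    set Y : Matrix (Fin 2) (Fin 2) k :=
      !![0, (c t 0 1) / (a ^ 2 - 1); (c t 1 0) * a ^ 2 / (1 - a ^ 2), 0] with hYd
    have hY : Y.trace = 0 := by simp [hYd, Matrix.trace_fin_two]
    apply step c Y hY
    obtain ⟨h1, h2'⟩ := shift c Y hY htr hc
    refine main2 (fun g => c g - ((g : GL (Fin 2) k).val * Y * ((g : GL (Fin 2) k)⁻¹).val - Y))
        h1 h2' ?_
    have ha2n : 1 - a ^ 2 ≠ 0 := fun h => ha2 (by linear_combination -h)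
    simp only [tv, ti]
    ext i j; fin_cases i <;> fin_cases j <;> simp [hYd, hp, hs]
    · field_simp; ring
    · field_simp; ring
  clear htr hc c
  intro c htr hc hct hcw
  have h1 : c 1 = 0 := by have := hc 1 1; simpa using this
  have hinv : ∀ g : H, c g = 0 → c g⁻¹ = 0 := by
    intro g hg
    have := hc g⁻¹ g
    rw [inv_mul_cancel, h1, hg] at this
    simpa using this.symm
  -- shape of c on unipotents
  have shape : ∀ (b : k) (hb : uu b ∈ H), c ⟨uu b, hb⟩ 0 0 = 0 ∧ c ⟨uu b, hb⟩ 1 0 = 0 ∧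
      c ⟨uu b, hb⟩ 1 1 = 0 := by
    intro b hb
    by_cases hb0 : b = 0
    · subst hb0
      have : (⟨uu 0, hb⟩ : H) = 1 := by
        apply Subtype.ext; apply Units.ext
        ext i j; fin_cases i <;> fin_cases j <;> simp [uu_val]
      rw [this, h1]; simp
    have uv : ((⟨uu b, hb⟩ : H) : GL (Fin 2) k).val = !![1, b; 0, 1] := rfl
    have e0 := htr ⟨uu b, hb⟩
    have e1 := tr0 c hc (⟨uu b, hb⟩ * t) (by
      rw [Subgroup.coe_mul, Units.val_mul, tv, uv]
      simpa [Matrix.trace_fin_two, Matrix.det_fin_two, ha] using hdisc)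
    have e2 := tr0 c hc (⟨uu b, hb⟩ * t⁻¹) (by
      rw [Subgroup.coe_mul, Units.val_mul, Subgroup.coe_inv, ti, uv]
      simpa [Matrix.trace_fin_two, Matrix.det_fin_two, ha, add_comm] using hdisc)
    rw [hc, hct, Subgroup.coe_mul, Units.val_mul, tv, uv] at e1
    rw [hc, hinv t hct, Subgroup.coe_mul, Units.val_mul, Subgroup.coe_inv, ti, uv] at e2
    simp [Matrix.trace_fin_two, Matrix.mul_apply, Fin.sum_univ_two, Matrix.vecMul, dotProduct] at e0 e1 e2
    generalize c ⟨uu b, hb⟩ 0 0 = p at *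
    generalize c ⟨uu b, hb⟩ 1 0 = r at *
    generalize c ⟨uu b, hb⟩ 1 1 = s at *
    have hs : s = -p := by linear_combination e0
    subst hs
    field_simp at e1 e2
    have hr : r = 0 := by
      have : b * (a ^ 2 + 1) * r = 0 := by linear_combination e1 + e2
      exact (mul_eq_zero.1 this).resolve_left (mul_ne_zero hb0 ha2')
    subst hr
    have hp : p = 0 := by
      have : (a ^ 2 - 1) * p = 0 := by linear_combination e1
      exact (mul_eq_zero.1 this).resolve_left ha2
    simp [hp]
  have van1 : ∀ (b : k) (hb : uu b ∈ H), b ^ 2 ≠ 4 → c ⟨uu b, hb⟩ = 0 := by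
    intro b hb hb4
    obtain ⟨s1, s2, s3⟩ := shape b hb
    have uv : ((⟨uu b, hb⟩ : H) : GL (Fin 2) k).val = !![1, b; 0, 1] := rfl
    have e1 := tr0 c hc (⟨uu b, hb⟩ * w) (by
      rw [Subgroup.coe_mul, Units.val_mul, wv, uv]
      simpa [Matrix.trace_fin_two, Matrix.det_fin_two] using hb4)
    rw [hc, hcw, Subgroup.coe_mul, Units.val_mul, wv, uv] at e1
    simp [Matrix.trace_fin_two, Matrix.mul_apply, Fin.sum_univ_two, s1, s2, s3] at e1
    ext i j; fin_cases i <;> fin_cases j <;> simp [s1, s2, s3, e1]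
  have h14 : (1 : k) ^ 2 ≠ 4 := fun h => h3 (by linear_combination -h)
  have hadd : ∀ b b' : k, uu b * uu b' = uu (b + b') := by
    intro b b'
    apply Units.ext; rw [Units.val_mul, uu_val, uu_val, uu_val]
    ext i j; fin_cases i <;> fin_cases j <;> simp [add_comm]
  have cmul : ∀ g h : H, c g = 0 → c h = 0 → c (g * h) = 0 := by
    intro g h hg hh; rw [hc, hg, hh]; simp
  have van : ∀ (b : k) (hb : uu b ∈ H), c ⟨uu b, hb⟩ = 0 := by
    intro b hb
    by_cases hb4 : b ^ 2 = 4
    · have : (b - 2) * (b + 2) = 0 := by linear_combination hb4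
      have hv1 := van1 1 hu h14
      have hv2 := cmul _ _ hv1 hv1
      rcases mul_eq_zero.1 this with h | h
      · have : (⟨uu b, hb⟩ : H) = ⟨uu 1, hu⟩ * ⟨uu 1, hu⟩ := by
          apply Subtype.ext
          rw [Subgroup.coe_mul]
          simp only [hadd]
          congr 1; linear_combination h
        rw [this]; exact hv2
      · have : (⟨uu b, hb⟩ : H) = (⟨uu 1, hu⟩ * ⟨uu 1, hu⟩)⁻¹ := by
          rw [eq_inv_iff_mul_eq_one]
          apply Subtype.ext
          rw [Subgroup.coe_mul, Subgroup.coe_mul]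
          simp only [hadd]
          have : b + (1 + 1) = 0 := by linear_combination h
          rw [this]
          apply Units.ext
          ext i j; fin_cases i <;> fin_cases j <;> simp [uu_val]
        rw [this]; exact hinv _ hv2
    · exact van1 b hb hb4
  -- transfer
  let S : Subgroup H :=
    { carrier := {g | c g = 0}
      mul_mem' := fun {g h} hg hh => cmul g h hg hh
      one_mem' := h1
      inv_mem' := fun {g} hg => hinv g hg }
  obtain ⟨P, hP⟩ := exists_sylow l H hu
  have hPS : (P : Subgroup H) ≤ S := by
    intro g hg
    obtain ⟨b, hb⟩ := hP g hg
    have hbH : uu b ∈ H := hb ▸ g.2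
    have : g = ⟨uu b, hbH⟩ := Subtype.ext hb
    rw [this]; exact van b hbH
  have hidx : ((S.index : ℕ) : k) ≠ 0 := by
    intro h
    rw [CharP.cast_eq_zero_iff k l] at h
    exact P.not_dvd_index (h.trans (Subgroup.index_dvd_of_le hPS))
  haveI : Fintype (H ⧸ S) := Fintype.ofFinite _
  let cb : H ⧸ S → Matrix (Fin 2) (Fin 2) k := Quotient.lift c (by
    intro g h hgh
    have hgh' : c (g⁻¹ * h) = 0 := QuotientGroup.leftRel_apply.1 hgh
    have : h = g * (g⁻¹ * h) := by group
    rw [this, hc, hgh']; simp)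
  have hcb : ∀ g : H, cb (g : H ⧸ S) = c g := fun g => rfl
  have hcb2 : ∀ (g : H) (x : H ⧸ S), cb (g • x) =
      c g + (g : GL (Fin 2) k).val * cb x * ((g : GL (Fin 2) k)⁻¹).val := by
    intro g x
    induction x using QuotientGroup.induction_on with
    | H h => exact hc g h
  have hcbt : ∀ x : H ⧸ S, (cb x).trace = 0 := by
    intro x
    induction x using QuotientGroup.induction_on with
    | H h => exact htr h
  set Z := ∑ x : H ⧸ S, cb x with hZ
  have hZtr : Z.trace = 0 := by
    rw [hZ, Matrix.trace_sum]; exact Finset.sum_eq_zero fun x _ => hcbt x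
  have hZg : ∀ g : H, Z = (S.index : k) • c g +
      (g : GL (Fin 2) k).val * Z * ((g : GL (Fin 2) k)⁻¹).val := by
    intro g
    have : Z = ∑ x : H ⧸ S, cb (g • x) :=
      (Equiv.sum_comp (MulAction.toPerm g : Equiv.Perm (H ⧸ S)) cb).symm
    conv_lhs => rw [this]
    simp only [hcb2]
    rw [Finset.sum_add_distrib, ← Finset.sum_mul, ← Finset.mul_sum, Finset.sum_const,
      Finset.card_univ, ← Nat.card_eq_fintype_card, ← Subgroup.index, Nat.cast_smul_eq_nsmul]
  refine ⟨-((S.index : k)⁻¹ • Z), by simp [hZtr], fun g => ?_⟩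
  have := hZg g
  have e : c g = (S.index : k)⁻¹ •
      (Z - (g : GL (Fin 2) k).val * Z * ((g : GL (Fin 2) k)⁻¹).val) := by
    have h' : Z - (g : GL (Fin 2) k).val * Z * ((g : GL (Fin 2) k)⁻¹).val =
        (S.index : k) • c g := sub_eq_of_eq_add this
    rw [h', smul_smul, inv_mul_cancel₀ hidx, one_smul]
  rw [e, smul_sub]
  simp only [mul_neg, neg_mul, mul_smul_comm, smul_mul_assoc]
  abel

private lemma exists_a (k' : Subfield k) (hfin : (k' : Set k).Finite) (hcard : 5 < Nat.card k') :
    ∃ a : k, a ∈ k' ∧ a ≠ 0 ∧ a ^ 4 ≠ 1 := by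
  by_contra hcon
  push Not at hcon
  have hdeg : (X ^ 5 - X : k[X]).natDegree = 5 := by compute_degree!
  have hne : (X ^ 5 - X : k[X]) ≠ 0 := by
    intro h; rw [h] at hdeg; simp at hdeg
  classical
  have hsub : (k' : Set k) ⊆ ((X ^ 5 - X : k[X]).roots.toFinset : Set k) := by
    intro x hx
    simp [hne]
    by_cases hx0 : x = 0
    · simp [hx0]
    · have := hcon x hx hx0
      linear_combination x * this
  have h1 := Set.ncard_le_ncard hsub (Finset.finite_toSet _)
  rw [Set.ncard_coe_finset] at h1
  have h2 := (Multiset.toFinset_card_le (X ^ 5 - X : k[X]).roots).trans (Polynomial.card_roots' _)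
  have h3 : (k' : Set k).ncard = Nat.card k' := rfl
  omega

end helpers

/-- let `l > 3` be prime, `k` algebraic over `𝔽_l`, and `k'` a finite
subfield of `k` with more than 5 elements.  Any finite subgroup `H ≤ GL₂(k)` containing
`SL₂(k')` (all matrices with entries in `k'` and determinant `1`) is 2-big. -/
theorem isTwoBig_of_finite_contains_SL2 (l : ℕ) [Fact l.Prime] (hl : 3 < l)
    (k : Type*) [Field k] [Algebra (ZMod l) k] [Algebra.IsAlgebraic (ZMod l) k]
    (k' : Subfield k) (hfin : (k' : Set k).Finite) (hcard : 5 < Nat.card k')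
    (H : Subgroup (GL (Fin 2) k)) (hHfin : (H : Set (GL (Fin 2) k)).Finite)
    (hSL : ∀ g : GL (Fin 2) k, (∀ i j, g.val i j ∈ k') → g.val.det = 1 → g ∈ H) :
    IsMBig l 2 H := by
  have : CharP k l := charP_of_injective_algebraMap (algebraMap (ZMod l) k).injective l
  have : Finite H := hHfin
  have cast_ne : ∀ n : ℕ, 0 < n → n < l → (n : k) ≠ 0 := by
    intro n h0 h1 h
    rw [CharP.cast_eq_zero_iff k l] at h
    exact absurd (Nat.le_of_dvd h0 h) (by omega)
  have h2 : (2 : k) ≠ 0 := by exact_mod_cast cast_ne 2 (by omega) (by omega)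
  have h3 : (3 : k) ≠ 0 := by exact_mod_cast cast_ne 3 (by omega) (by omega)
  obtain ⟨a, hak, ha, ha4⟩ := exists_a k' hfin hcard
  have ha2 : a ^ 2 ≠ 1 := fun h => ha4 (by linear_combination (a ^ 2 + 1) * h)
  have hu : uu (1 : k) ∈ H := by
    apply hSL
    · intro i j
      fin_cases i <;> fin_cases j <;> simp [uu_val, k'.zero_mem, k'.one_mem]
    · simp [uu_val]
  have hw : ww (k := k) ∈ H := by
    apply hSL
    · intro i j
      fin_cases i <;> fin_cases j <;> simp [ww_val, k'.zero_mem, k'.one_mem]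
    · simp [ww_val]
  have ht : tt a ha ∈ H := by
    apply hSL
    · intro i j
      fin_cases i <;> fin_cases j <;> simp [tt_val, k'.zero_mem, hak]
    · simp [tt_val, ha]
  refine ⟨part_i l H hu h2 a ha ha2 ht, ?_, fun c htr hc =>
    part_iii l H hu hw h2 h3 a ha ha4 ht c htr hc, ?_⟩
  · intro X hX hcomm
    have e1 := hcomm ⟨_, hu⟩
    have e2 := hcomm ⟨_, hw⟩
    simp only [uu_val, ww_val] at e1 e2
    have a1 := congrFun (congrFun e1 0) 0
    have a2 := congrFun (congrFun e1 0) 1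
    have a3 := congrFun (congrFun e2 0) 0
    simp [Matrix.mul_apply, Fin.sum_univ_two, Matrix.vecMul, dotProduct] at a1 a2 a3
    rw [Matrix.trace_fin_two] at hX
    have h10 : X 1 0 = 0 := by linear_combination a1
    have h01 : X 0 1 = 0 := by linear_combination a3 - h10
    have h00 : X 0 0 = 0 := by
      have : 2 * X 0 0 = 0 := by linear_combination hX - a2
      exact (mul_eq_zero.1 this).resolve_left h2
    have h11 : X 1 1 = 0 := by linear_combination hX - h00
    ext i j; fin_cases i <;> fin_cases j <;> simp [h10, h01, h00, h11]
  · intro W hW hne _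
    have hw00 : ∃ w ∈ W, w 0 0 ≠ 0 := by
      by_contra hcon
      push Not at hcon
      apply hne
      rw [Submodule.eq_bot_iff]
      have key : ∀ x ∈ W, x 1 1 = 0 ∧ x 1 0 = 0 := by
        intro x hx
        have c1 := hcon _ (hW x hx ⟨_, hw⟩)
        have c2 := hcon _ (hW x hx ⟨_, hu⟩)
        have c0 := hcon x hx
        simp only [uu_val, uu_inv, ww_val, ww_inv] at c1 c2
        simp [Matrix.mul_apply, Fin.sum_univ_two, Matrix.vecMul, dotProduct] at c1 c2
        exact ⟨c1, by linear_combination c2 - c0⟩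
      intro x hx
      have c0 := hcon x hx
      obtain ⟨c1, c2⟩ := key x hx
      have c3 := (key _ (hW x hx ⟨_, hw⟩)).2
      simp only [ww_val, ww_inv] at c3
      simp [Matrix.mul_apply, Fin.sum_univ_two, Matrix.vecMul, dotProduct] at c3
      ext i j; fin_cases i <;> fin_cases j <;> simp [c0, c1, c2, c3]
    obtain ⟨w, hwW, hw0⟩ := hw00
    have hne' : a - a⁻¹ ≠ 0 := by
      intro h
      field_simp at h
      exact ha2 (by linear_combination h)
    have hcp : (tt a ha).val.charpoly = (X - C a) * (X - C a⁻¹) := by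
      rw [Matrix.charpoly_fin_two, tt_val]
      simp [Matrix.trace_fin_two, ha]
      have : (C a * C a⁻¹ : k[X]) = 1 := by rw [← C_mul, mul_inv_cancel₀ ha, C_1]
      linear_combination -this
    have hep : eigProj (tt a ha).val a = !![1, 0; 0, 0] := by
      rw [eigProj, tt_val]
      ext i j; fin_cases i <;> fin_cases j <;> simp [Matrix.trace_fin_two, hne']
    refine ⟨⟨_, ht⟩, a, ?_, ?_, w, hwW, ?_⟩
    · simp only [hcp]
      rw [rootMultiplicity_mul (mul_ne_zero (X_sub_C_ne_zero _) (X_sub_C_ne_zero _)),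
        rootMultiplicity_X_sub_C_self, rootMultiplicity_eq_zero]
      simpa using hne'
    · intro β hβ hβa hsq
      simp only [hcp] at hβ
      simp [sub_eq_zero, hβa] at hβ
      subst hβ
      apply ha4
      field_simp at hsq
      linear_combination hsq
    · intro h
      simp only [hep] at h
      have := congrFun (congrFun h 0) 0
      simp [Matrix.mul_apply, Fin.sum_univ_two, Matrix.vecMul, dotProduct] at this
      exact hw0 this
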